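/- Let 0<α<1 and 0<β<∞, let u be holomorphic on 𝔻 and φ a holomorphic self-map of 𝔻. Then uC_φ maps B^α boundedly into Z_β if and only if u ∈ Z_β, sup_{z∈𝔻} (1-|z|²)^β |2u'(z)φ'(z) + u(z)φ''(z)| / (1-|φ(z)|²)^α < ∞, and sup_{z∈𝔻} (1-|z|²)^β |u(z)| |φ'(z)|² / (1-|φ(z)|²)^{α+1} < ∞. -/

import Mathlib

open Complex Filter Set

noncomputable section

/-- The open unit disk in `ℂ`. -/
def unitDisk : Set ℂ := Metric.ball 0 1

/-- The weighted sup-norm `‖g‖_{ν_γ} = sup_{z ∈ 𝔻} (1-|z|²)^γ |g(z)|`. -/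
def wnorm (γ : ℝ) (g : ℂ → ℂ) : ℝ :=
  sSup ((fun z => (1 - ‖z‖ ^ 2) ^ γ * ‖g z‖) '' unitDisk)

/-- Membership in the weighted Banach space `H^∞_{ν_β}`. -/
def MemWeighted (β : ℝ) (g : ℂ → ℂ) : Prop :=
  DifferentiableOn ℂ g unitDisk ∧
    BddAbove ((fun z => (1 - ‖z‖ ^ 2) ^ β * ‖g z‖) '' unitDisk)

/-- Membership in the Bloch type space `B^α`. -/
def MemBloch (α : ℝ) (f : ℂ → ℂ) : Prop :=
  DifferentiableOn ℂ f unitDisk ∧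
    BddAbove ((fun z => (1 - ‖z‖ ^ 2) ^ α * ‖deriv f z‖) '' unitDisk)

/-- The Bloch type norm `‖f‖_{B^α} = |f(0)| + sup_{z∈𝔻}(1-|z|²)^α |f'(z)|`. -/
def blochNorm (α : ℝ) (f : ℂ → ℂ) : ℝ :=
  ‖f 0‖ + wnorm α (deriv f)

/-- Membership in the Zygmund type space `Z_β`. -/
def MemZygmund (β : ℝ) (f : ℂ → ℂ) : Prop :=
  DifferentiableOn ℂ f unitDisk ∧
    BddAbove ((fun z => (1 - ‖z‖ ^ 2) ^ β * ‖deriv (deriv f) z‖) '' unitDisk)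

/-- The Zygmund type norm `‖f‖_{Z_β} = |f(0)| + |f'(0)| + sup_{z∈𝔻}(1-|z|²)^β |f''(z)|`. -/
def zygNorm (β : ℝ) (f : ℂ → ℂ) : ℝ :=
  ‖f 0‖ + ‖deriv f 0‖ + wnorm β (deriv (deriv f))

/-- The weighted composition operator `uC_φ f = u · (f ∘ φ)`. -/
def wcomp (u φ f : ℂ → ℂ) : ℂ → ℂ := fun z => u z * f (φ z)

/-- `uC_φ` maps `B^α` boundedly into `Z_β`. -/
def BoundedBlochToZygmund (α β : ℝ) (u φ : ℂ → ℂ) : Prop :=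
  (∀ f, MemBloch α f → MemZygmund β (wcomp u φ f)) ∧
    ∃ C > 0, ∀ f, MemBloch α f → zygNorm β (wcomp u φ f) ≤ C * blochNorm α f

/-- `uC_φ` maps `B^α` boundedly into `H^∞_{ν_β}`. -/
def BoundedBlochToWeighted (α β : ℝ) (u φ : ℂ → ℂ) : Prop :=
  (∀ f, MemBloch α f → MemWeighted β (wcomp u φ f)) ∧
    ∃ C > 0, ∀ f, MemBloch α f → wnorm β (wcomp u φ f) ≤ C * blochNorm α f

/-- `uC_φ : B^α → Z_β` is compact: it is bounded and maps bounded sets of `B^α` to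
totally bounded (equivalently, since `Z_β` is complete, relatively compact) subsets
of `Z_β`. -/
def CompactBlochToZygmund (α β : ℝ) (u φ : ℂ → ℂ) : Prop :=
  BoundedBlochToZygmund α β u φ ∧
    ∀ r : ℝ, ∀ ε : ℝ, 0 < ε → ∃ T : Finset (ℂ → ℂ),
      (∀ g ∈ T, MemZygmund β g) ∧
      ∀ f, MemBloch α f → blochNorm α f ≤ r →
        ∃ g ∈ T, zygNorm β (fun z => wcomp u φ f z - g z) ≤ ε

/-- `uC_φ : B^α → H^∞_{ν_β}` is compact: it is bounded and maps bounded sets of `B^α`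
to totally bounded (equivalently, relatively compact) subsets of `H^∞_{ν_β}`. -/
def CompactBlochToWeighted (α β : ℝ) (u φ : ℂ → ℂ) : Prop :=
  BoundedBlochToWeighted α β u φ ∧
    ∀ r : ℝ, ∀ ε : ℝ, 0 < ε → ∃ T : Finset (ℂ → ℂ),
      (∀ g ∈ T, MemWeighted β g) ∧
      ∀ f, MemBloch α f → blochNorm α f ≤ r →
        ∃ g ∈ T, wnorm β (fun z => wcomp u φ f z - g z) ≤ ε

/-- A compact (linear, bounded, with totally bounded image of the unit ball) operator
from the subspace of `B^α` cut out by the predicate `P` into `Z_β`. -/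
def IsCompactOpToZygmund (α β : ℝ) (P : (ℂ → ℂ) → Prop) (K : (ℂ → ℂ) → ℂ → ℂ) : Prop :=
  (∀ f g, P f → P g → ∀ a b : ℂ,
      K (fun z => a * f z + b * g z) = fun z => a * K f z + b * K g z) ∧
  (∀ f, P f → MemZygmund β (K f)) ∧
  (∃ C, ∀ f, P f → zygNorm β (K f) ≤ C * blochNorm α f) ∧
  (∀ ε : ℝ, 0 < ε → ∃ T : Finset (ℂ → ℂ), (∀ g ∈ T, MemZygmund β g) ∧
      ∀ f, P f → blochNorm α f ≤ 1 → ∃ g ∈ T, zygNorm β (fun z => K f z - g z) ≤ ε)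

/-- The essential norm of `uC_φ`, as an operator from the subspace of `B^α` cut out by
the predicate `P` into `Z_β`: the distance to the compact operators, the operator norm
being the supremum over the unit ball. -/
def essNormZ (α β : ℝ) (P : (ℂ → ℂ) → Prop) (u φ : ℂ → ℂ) : ℝ :=
  sInf {r | ∃ K, IsCompactOpToZygmund α β P K ∧
    r = sSup {s | ∃ f, P f ∧ blochNorm α f ≤ 1 ∧
          s = zygNorm β (fun z => wcomp u φ f z - K f z)}}

/-- A compact (linear, bounded, with totally bounded image of the unit ball) operator
from `B^α` into `H^∞_{ν_β}`. -/
def IsCompactOpToWeighted (α β : ℝ) (K : (ℂ → ℂ) → ℂ → ℂ) : Prop :=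
  (∀ f g, MemBloch α f → MemBloch α g → ∀ a b : ℂ,
      K (fun z => a * f z + b * g z) = fun z => a * K f z + b * K g z) ∧
  (∀ f, MemBloch α f → MemWeighted β (K f)) ∧
  (∃ C, ∀ f, MemBloch α f → wnorm β (K f) ≤ C * blochNorm α f) ∧
  (∀ ε : ℝ, 0 < ε → ∃ T : Finset (ℂ → ℂ), (∀ g ∈ T, MemWeighted β g) ∧
      ∀ f, MemBloch α f → blochNorm α f ≤ 1 → ∃ g ∈ T, wnorm β (fun z => K f z - g z) ≤ ε)

/-- The essential norm of `uC_φ : B^α → H^∞_{ν_β}`. -/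
def essNormW (α β : ℝ) (u φ : ℂ → ℂ) : ℝ :=
  sInf {r | ∃ K, IsCompactOpToWeighted α β K ∧
    r = sSup {s | ∃ f, MemBloch α f ∧ blochNorm α f ≤ 1 ∧
          s = wnorm β (fun z => wcomp u φ f z - K f z)}}

/-- `limsup_{|φ(z)|→1} F(z) = lim_{s→1⁻} sup {F z : z ∈ 𝔻, |φ z| > s}`.  Since the inner
supremum is nonincreasing in `s`, the limit equals the infimum over `s ∈ [0,1)`; note
that `Real.sSup ∅ = 0`, matching the convention that the value is `0` when
`{z : |φ z| > s}` is empty for some `s < 1`. -/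
def phiLimsup (φ : ℂ → ℂ) (F : ℂ → ℝ) : ℝ :=
  sInf ((fun s => sSup {y | ∃ z ∈ unitDisk, s < ‖φ z‖ ∧ y = F z}) '' Set.Ico (0:ℝ) 1)

lemma isOpen_unitDisk : IsOpen unitDisk := Metric.isOpen_ball

lemma mem_unitDisk {z : ℂ} : z ∈ unitDisk ↔ ‖z‖ < 1 := by simp [unitDisk]

lemma zero_mem_unitDisk : (0 : ℂ) ∈ unitDisk := by simp [mem_unitDisk]

lemma one_sub_norm_sq_pos {z : ℂ} (hz : z ∈ unitDisk) : 0 < 1 - ‖z‖ ^ 2 := by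
  have := mem_unitDisk.1 hz
  nlinarith [norm_nonneg z]

/-- Growth of functions whose derivative is `O((1-|z|²)^{-α})` with `α < 1`: they are bounded. -/
lemma norm_sub_zero_le_of_bloch {α M : ℝ} (hα0 : 0 < α) (hα1 : α < 1) {f : ℂ → ℂ}
    (hf : DifferentiableOn ℂ f unitDisk)
    (hM : ∀ z ∈ unitDisk, (1 - ‖z‖ ^ 2) ^ α * ‖deriv f z‖ ≤ M) {z : ℂ} (hz : z ∈ unitDisk) :
    ‖f z - f 0‖ ≤ M / (1 - α) := by
  have hM0 : 0 ≤ M := le_trans (by simp) (hM 0 zero_mem_unitDisk)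
  have hr := mem_unitDisk.1 hz
  have hr0 := norm_nonneg z
  have h1α : 0 < 1 - α := by linarith
  have htr : ∀ t ∈ Icc (0 : ℝ) 1, t * ‖z‖ < 1 := fun t ht => by nlinarith [ht.1, ht.2]
  have hnorm : ∀ t ∈ Icc (0 : ℝ) 1, ‖(t : ℂ) * z‖ = t * ‖z‖ := fun t ht => by
    simp [abs_of_nonneg ht.1]
  have hmem : ∀ t ∈ Icc (0 : ℝ) 1, (t : ℂ) * z ∈ unitDisk := fun t ht => by
    rw [mem_unitDisk, hnorm t ht]; exact htr t ht
  have hF : ∀ t ∈ Icc (0 : ℝ) 1,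
      HasDerivAt (fun t : ℝ => f ((t : ℂ) * z) - f 0) (deriv f (t * z) * z) t := by
    intro t ht
    have h1 := (hf.differentiableAt (isOpen_unitDisk.mem_nhds (hmem t ht))).hasDerivAt
    have h2 : HasDerivAt (fun s : ℂ => s * z) z (t : ℂ) := by
      simpa using (hasDerivAt_id (t : ℂ)).mul_const z
    exact (HasDerivAt.comp (t : ℂ) h1 h2).comp_ofReal.sub_const _
  have hB : ∀ t ∈ Icc (0 : ℝ) 1,
      HasDerivAt (fun t : ℝ => M / (1 - α) * (1 - (1 - t * ‖z‖) ^ (1 - α)))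
        (M * ‖z‖ * (1 - t * ‖z‖) ^ (-α)) t := by
    intro t ht
    have hpos : 1 - t * ‖z‖ ≠ 0 := by linarith [htr t ht]
    have h1 : HasDerivAt (fun t : ℝ => 1 - t * ‖z‖) (-‖z‖) t := by
      simpa using ((hasDerivAt_id t).mul_const ‖z‖).const_sub 1
    have h2 := ((h1.rpow_const (p := 1 - α) (Or.inl hpos)).const_sub 1).const_mul (M / (1 - α))
    refine h2.congr_deriv ?_
    rw [show 1 - α - 1 = -α by ring]
    field_simp
  have key := image_norm_le_of_norm_deriv_right_le_deriv_boundary' (a := 0) (b := 1)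
    (fun t ht => (hF t ht).continuousAt.continuousWithinAt)
    (fun t ht => (hF t (Ico_subset_Icc_self ht)).hasDerivWithinAt)
    (by simp)
    (fun t ht => (hB t ht).continuousAt.continuousWithinAt)
    (fun t ht => (hB t (Ico_subset_Icc_self ht)).hasDerivWithinAt)
    (fun t ht => by
      have ht' := Ico_subset_Icc_self ht
      have h1 := hM _ (hmem t ht')
      rw [hnorm t ht'] at h1
      have hpos : 0 < 1 - t * ‖z‖ := by linarith [htr t ht']
      have h2 : (1 - t * ‖z‖) ^ α ≤ (1 - (t * ‖z‖) ^ 2) ^ α := by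
        apply Real.rpow_le_rpow hpos.le _ hα0.le
        nlinarith [mul_nonneg ht.1 hr0]
      have h3 : ‖deriv f (t * z)‖ ≤ M * (1 - t * ‖z‖) ^ (-α) := by
        rw [Real.rpow_neg hpos.le, ← div_eq_mul_inv, le_div_iff₀ (Real.rpow_pos_of_pos hpos _)]
        nlinarith [norm_nonneg (deriv f (t * z))]
      rw [norm_mul]
      nlinarith)
    (right_mem_Icc.2 zero_le_one)
  simp only [ofReal_one, one_mul] at key
  refine key.trans (mul_le_of_le_one_right (by positivity) ?_)
  have : 0 ≤ (1 - ‖z‖) ^ (1 - α) := Real.rpow_nonneg (by linarith) _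
  linarith

/-- Cauchy estimate for the second derivative of a Bloch type function. -/
lemma norm_deriv_deriv_le_of_bloch {α M : ℝ} (hα0 : 0 < α) {f : ℂ → ℂ}
    (hf : DifferentiableOn ℂ f unitDisk)
    (hM : ∀ z ∈ unitDisk, (1 - ‖z‖ ^ 2) ^ α * ‖deriv f z‖ ≤ M) {w : ℂ} (hw : w ∈ unitDisk) :
    (1 - ‖w‖ ^ 2) ^ (α + 1) * ‖deriv (deriv f) w‖ ≤ 4 ^ (α + 1) * M := by
  have hp := one_sub_norm_sq_pos hw
  have hw1 := mem_unitDisk.1 hw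
  have hw0 := norm_nonneg w
  set p := 1 - ‖w‖ ^ 2 with hpdef
  have hpw : p / 4 ≤ (1 - ‖w‖) / 2 := by nlinarith
  have hball : Metric.closedBall w (p / 4) ⊆ unitDisk := fun ζ hζ => by
    rw [mem_closedBall_iff_norm] at hζ
    rw [mem_unitDisk]
    have := norm_le_insert' ζ w
    linarith
  have hd : DiffContOnCl ℂ (deriv f) (Metric.ball w (p / 4)) :=
    ((hf.deriv isOpen_unitDisk).mono hball).diffContOnCl_ball subset_rfl
  have hC : ∀ ζ ∈ Metric.sphere w (p / 4), ‖deriv f ζ‖ ≤ M / (p / 4) ^ α := fun ζ hζ => by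
    have hζ' := hball (Metric.sphere_subset_closedBall hζ)
    have h1 := hM ζ hζ'
    rw [mem_sphere_iff_norm] at hζ
    have h3 := norm_le_insert' ζ w
    have h4 := mem_unitDisk.1 hζ'
    have h2 : (p / 4) ^ α ≤ (1 - ‖ζ‖ ^ 2) ^ α := by
      apply Real.rpow_le_rpow (by positivity) _ hα0.le
      nlinarith [norm_nonneg ζ]
    rw [le_div_iff₀ (by positivity)]
    nlinarith [norm_nonneg (deriv f ζ)]
  have key := Complex.norm_deriv_le_of_forall_mem_sphere_norm_le (by positivity) hd hC
  rw [div_div, ← Real.rpow_add_one (by positivity), Real.div_rpow hp.le (by norm_num),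
    le_div_iff₀ (by positivity)] at key
  rw [mul_div_assoc', div_le_iff₀ (by positivity)] at key
  linarith

lemma le_wnorm {γ : ℝ} {g : ℂ → ℂ}
    (h : BddAbove ((fun z => (1 - ‖z‖ ^ 2) ^ γ * ‖g z‖) '' unitDisk)) {z : ℂ}
    (hz : z ∈ unitDisk) : (1 - ‖z‖ ^ 2) ^ γ * ‖g z‖ ≤ wnorm γ g :=
  le_csSup h (mem_image_of_mem _ hz)

lemma wnorm_le {γ K : ℝ} {g : ℂ → ℂ}
    (h : ∀ z ∈ unitDisk, (1 - ‖z‖ ^ 2) ^ γ * ‖g z‖ ≤ K) : wnorm γ g ≤ K :=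
  csSup_le (Set.Nonempty.image _ ⟨0, zero_mem_unitDisk⟩) (forall_mem_image.2 h)

lemma hasDerivAt_wcomp {u φ f : ℂ → ℂ} (hu : DifferentiableOn ℂ u unitDisk)
    (hφd : DifferentiableOn ℂ φ unitDisk) (hφm : MapsTo φ unitDisk unitDisk)
    (hf : DifferentiableOn ℂ f unitDisk) {z : ℂ} (hz : z ∈ unitDisk) :
    HasDerivAt (wcomp u φ f) (deriv u z * f (φ z) + u z * (deriv f (φ z) * deriv φ z)) z := by
  have hu' := (hu.differentiableAt (isOpen_unitDisk.mem_nhds hz)).hasDerivAt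
  have hφ' := (hφd.differentiableAt (isOpen_unitDisk.mem_nhds hz)).hasDerivAt
  have hf' := (hf.differentiableAt (isOpen_unitDisk.mem_nhds (hφm hz))).hasDerivAt
  exact hu'.mul (hf'.comp z hφ')

lemma deriv_deriv_wcomp {u φ f : ℂ → ℂ} (hu : DifferentiableOn ℂ u unitDisk)
    (hφd : DifferentiableOn ℂ φ unitDisk) (hφm : MapsTo φ unitDisk unitDisk)
    (hf : DifferentiableOn ℂ f unitDisk) {z : ℂ} (hz : z ∈ unitDisk) :
    deriv (deriv (wcomp u φ f)) z = deriv (deriv u) z * f (φ z)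
      + (2 * deriv u z * deriv φ z + u z * deriv (deriv φ) z) * deriv f (φ z)
      + u z * deriv φ z ^ 2 * deriv (deriv f) (φ z) := by
  have hev : deriv (wcomp u φ f) =ᶠ[nhds z]
      fun z => wcomp (deriv u) φ f z + wcomp u φ (deriv f) z * deriv φ z := by
    filter_upwards [isOpen_unitDisk.mem_nhds hz] with x hx
    rw [(hasDerivAt_wcomp hu hφd hφm hf hx).deriv]
    simp only [wcomp]; ring
  have h1 := hasDerivAt_wcomp (hu.deriv isOpen_unitDisk) hφd hφm hf hz
  have h2 := hasDerivAt_wcomp hu hφd hφm (hf.deriv isOpen_unitDisk) hz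
  have h3 := ((hφd.deriv isOpen_unitDisk).differentiableAt
    (isOpen_unitDisk.mem_nhds hz)).hasDerivAt
  rw [hev.deriv_eq]
  refine (h1.add (h2.mul h3)).deriv.trans ?_
  simp only [wcomp]; ring

/-- A bounded operator `uC_φ : B^α → Z_β` controls `(uC_φ f)''` in terms of any bound for the
derivative of a function `f` vanishing at the origin. -/
lemma exists_deriv_deriv_wcomp_le {α β : ℝ} {u φ : ℂ → ℂ} (h : BoundedBlochToZygmund α β u φ) :
    ∃ C > 0, ∀ f : ℂ → ℂ, ∀ N : ℝ, DifferentiableOn ℂ f unitDisk → f 0 = 0 →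
      (∀ z ∈ unitDisk, (1 - ‖z‖ ^ 2) ^ α * ‖deriv f z‖ ≤ N) → ∀ z ∈ unitDisk,
      (1 - ‖z‖ ^ 2) ^ β * ‖deriv (deriv (wcomp u φ f)) z‖ ≤ C * N := by
  obtain ⟨hmaps, C, hC, hbd⟩ := h
  refine ⟨C, hC, fun f N hf hf0 hN z hz => ?_⟩
  have hB : MemBloch α f := ⟨hf, N, forall_mem_image.2 hN⟩
  have h1 := le_wnorm (hmaps f hB).2 hz
  have h2 := hbd f hB
  have h3 : blochNorm α f ≤ N := by
    rw [blochNorm, hf0, norm_zero, zero_add]; exact wnorm_le hN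
  have h4 : C * blochNorm α f ≤ C * N := by gcongr
  unfold zygNorm at h2
  linarith [norm_nonneg (wcomp u φ f 0), norm_nonneg (deriv (wcomp u φ f) 0)]

/-- Every holomorphic function on the disk is the derivative of one vanishing at `0`. -/
lemma exists_primitive {g : ℂ → ℂ} (hg : DifferentiableOn ℂ g unitDisk) :
    ∃ f : ℂ → ℂ, DifferentiableOn ℂ f unitDisk ∧ f 0 = 0 ∧ (∀ z ∈ unitDisk, deriv f z = g z) ∧
      ∀ z ∈ unitDisk, deriv (deriv f) z = deriv g z := by
  obtain ⟨f, hf0, hf⟩ := (DifferentiableOn.isExactOn_ball hg).with_val_at 0 0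
  have hd : ∀ z ∈ unitDisk, deriv f z = g z := fun z hz => (hf z hz).deriv
  refine ⟨f, fun z hz => (hf z hz).differentiableAt.differentiableWithinAt, hf0, hd,
    fun z hz => Filter.EventuallyEq.deriv_eq ?_⟩
  filter_upwards [isOpen_unitDisk.mem_nhds hz] with x hx using hd x hx

lemma norm_conj_mul_lt_one {w z : ℂ} (hw : w ∈ unitDisk) (hz : z ∈ unitDisk) :
    ‖starRingEnd ℂ w * z‖ < 1 := by
  rw [mem_unitDisk] at hw hz
  rw [norm_mul, RCLike.norm_conj]
  nlinarith [norm_nonneg w, norm_nonneg z]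

lemma one_sub_conj_mul_mem_slitPlane {w z : ℂ} (hw : w ∈ unitDisk) (hz : z ∈ unitDisk) :
    1 - starRingEnd ℂ w * z ∈ slitPlane := by
  refine Or.inl ?_
  have := (Complex.re_le_norm _).trans_lt (norm_conj_mul_lt_one hw hz)
  rw [sub_re, one_re]; linarith

lemma one_sub_conj_mul_self (w : ℂ) : 1 - starRingEnd ℂ w * w = ((1 - ‖w‖ ^ 2 : ℝ) : ℂ) := by
  rw [Complex.conj_mul']; push_cast; ring

/-- The kernel `(1 - w̄ z)^{-α}`. -/
def blochKernel (α : ℝ) (w z : ℂ) : ℂ := (1 - starRingEnd ℂ w * z) ^ ((-α : ℝ) : ℂ)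

lemma hasDerivAt_one_sub_conj_mul (w z : ℂ) :
    HasDerivAt (fun z => 1 - starRingEnd ℂ w * z) (-starRingEnd ℂ w) z := by
  simpa using ((hasDerivAt_id z).const_mul (starRingEnd ℂ w)).const_sub 1

lemma hasDerivAt_blochKernel (α : ℝ) {w z : ℂ} (hw : w ∈ unitDisk) (hz : z ∈ unitDisk) :
    HasDerivAt (blochKernel α w)
      (α * starRingEnd ℂ w * (1 - starRingEnd ℂ w * z) ^ ((-α - 1 : ℝ) : ℂ)) z := by
  have h := (hasDerivAt_one_sub_conj_mul w z).cpow_const (c := ((-α : ℝ) : ℂ))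
    (one_sub_conj_mul_mem_slitPlane hw hz)
  refine h.congr_deriv ?_
  push_cast
  ring

lemma norm_blochKernel_le {α : ℝ} (hα0 : 0 < α) {w z : ℂ} (hw : w ∈ unitDisk)
    (hz : z ∈ unitDisk) : (1 - ‖z‖ ^ 2) ^ α * ‖blochKernel α w z‖ ≤ 2 ^ α := by
  have hp := one_sub_norm_sq_pos hz
  have hw1 := mem_unitDisk.1 hw
  have hz1 := mem_unitDisk.1 hz
  have hlow : (1 - ‖z‖ ^ 2) / 2 ≤ ‖1 - starRingEnd ℂ w * z‖ := by
    have h1 := norm_sub_norm_le (1 : ℂ) (starRingEnd ℂ w * z)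
    rw [norm_one, norm_mul, RCLike.norm_conj] at h1
    nlinarith [norm_nonneg w, norm_nonneg z]
  rw [blochKernel, norm_cpow_real, Real.rpow_neg (norm_nonneg _), ← div_eq_mul_inv,
    div_le_iff₀ (Real.rpow_pos_of_pos (by linarith) _), ← Real.mul_rpow (by norm_num) (norm_nonneg _)]
  exact Real.rpow_le_rpow hp.le (by linarith) hα0.le

lemma norm_rpow_conj_self {w : ℂ} (hw : w ∈ unitDisk) (s : ℝ) :
    ‖(1 - starRingEnd ℂ w * w) ^ (s : ℂ)‖ = (1 - ‖w‖ ^ 2) ^ s := by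
  rw [norm_cpow_real, one_sub_conj_mul_self, norm_real,
    Real.norm_of_nonneg (one_sub_norm_sq_pos hw).le]

/-- The disk automorphism is bounded by one: `|z - w| ≤ |1 - w̄ z|`. -/
lemma norm_sub_le_norm_one_sub_conj_mul {w z : ℂ} (hw : w ∈ unitDisk) (hz : z ∈ unitDisk) :
    ‖z - w‖ ≤ ‖1 - starRingEnd ℂ w * z‖ := by
  have h1 := one_sub_norm_sq_pos hw
  have h2 := one_sub_norm_sq_pos hz
  refine (sq_le_sq₀ (norm_nonneg _) (norm_nonneg _)).1 ?_
  rw [← normSq_eq_norm_sq, normSq_apply] at h1 h2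
  rw [← normSq_eq_norm_sq, ← normSq_eq_norm_sq, normSq_apply, normSq_apply]
  simp only [sub_re, sub_im, mul_re, mul_im, conj_re, conj_im, one_re, one_im]
  nlinarith [mul_pos h1 h2]

lemma exists_bloch_norm_deriv_eq {α : ℝ} (hα0 : 0 < α) {w : ℂ} (hw : w ∈ unitDisk) :
    ∃ f : ℂ → ℂ, DifferentiableOn ℂ f unitDisk ∧ f 0 = 0 ∧
      (∀ z ∈ unitDisk, (1 - ‖z‖ ^ 2) ^ α * ‖deriv f z‖ ≤ 2 ^ α) ∧
      ‖deriv f w‖ = (1 - ‖w‖ ^ 2) ^ (-α) ∧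
      ‖deriv (deriv f) w‖ ≤ α * (1 - ‖w‖ ^ 2) ^ (-α - 1) := by
  have hd := fun z (hz : z ∈ unitDisk) => hasDerivAt_blochKernel α hw hz
  obtain ⟨f, hf, hf0, hf1, hf2⟩ := exists_primitive (g := blochKernel α w)
    fun z hz => (hd z hz).differentiableAt.differentiableWithinAt
  refine ⟨f, hf, hf0, fun z hz => ?_, ?_, ?_⟩
  · rw [hf1 z hz]; exact norm_blochKernel_le hα0 hw hz
  · rw [hf1 w hw, blochKernel, norm_rpow_conj_self hw]
  · rw [hf2 w hw, (hd w hw).deriv, norm_mul, norm_mul, norm_rpow_conj_self hw, norm_real,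
      RCLike.norm_conj, Real.norm_of_nonneg hα0.le]
    have := Real.rpow_pos_of_pos (one_sub_norm_sq_pos hw) (-α - 1)
    have hw1 := mem_unitDisk.1 hw
    gcongr
    nlinarith

lemma exists_bloch_norm_deriv_deriv_eq {α : ℝ} (hα0 : 0 < α) {w : ℂ} (hw : w ∈ unitDisk) :
    ∃ f : ℂ → ℂ, DifferentiableOn ℂ f unitDisk ∧ f 0 = 0 ∧
      (∀ z ∈ unitDisk, (1 - ‖z‖ ^ 2) ^ α * ‖deriv f z‖ ≤ 2 ^ α) ∧
      deriv f w = 0 ∧ ‖deriv (deriv f) w‖ = (1 - ‖w‖ ^ 2) ^ (-α - 1) := by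
  have hne : ∀ z ∈ unitDisk, 1 - starRingEnd ℂ w * z ≠ 0 := fun z hz =>
    slitPlane_ne_zero (one_sub_conj_mul_mem_slitPlane hw hz)
  have hd := fun z (hz : z ∈ unitDisk) =>
    (((hasDerivAt_id z).sub_const w).div (hasDerivAt_one_sub_conj_mul w z) (hne z hz)).mul
      (hasDerivAt_blochKernel α hw hz)
  obtain ⟨f, hf, hf0, hf1, hf2⟩ := exists_primitive
    fun z hz => (hd z hz).differentiableAt.differentiableWithinAt
  refine ⟨f, hf, hf0, fun z hz => ?_, ?_, ?_⟩
  · rw [hf1 z hz]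
    refine le_trans ?_ (norm_blochKernel_le hα0 hw hz)
    have : 0 ≤ (1 - ‖z‖ ^ 2) ^ α := Real.rpow_nonneg (one_sub_norm_sq_pos hz).le _
    gcongr
    simp only [Pi.mul_apply, Pi.div_apply, id, norm_mul, norm_div]
    refine mul_le_of_le_one_left (norm_nonneg _) (div_le_one_of_le₀ ?_ (norm_nonneg _))
    exact norm_sub_le_norm_one_sub_conj_mul hw hz
  · rw [hf1 w hw]; simp
  · rw [hf2 w hw, (hd w hw).deriv]
    have hp := one_sub_norm_sq_pos hw
    have h0 := hne w hw
    simp only [Pi.div_apply, id, sub_self, zero_div, zero_mul, add_zero, sub_zero, one_mul,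
      norm_mul, norm_div, norm_pow, blochKernel, norm_rpow_conj_self hw]
    rw [one_sub_conj_mul_self, norm_real, Real.norm_of_nonneg hp.le, Real.rpow_sub_one hp.ne']
    field_simp

lemma memZygmund_of_bounded {α β : ℝ} {u φ : ℂ → ℂ} (h : BoundedBlochToZygmund α β u φ) :
    MemZygmund β u := by
  have hB : MemBloch α (fun _ => 1) :=
    ⟨differentiableOn_const _, 0, forall_mem_image.2 fun z _ => by simp⟩
  have h1 : wcomp u φ (fun _ => 1) = u := by funext z; simp [wcomp]
  exact h1 ▸ h.1 _ hB

/-- Necessity of the pointwise conditions, from the kernel test functions. -/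
lemma pointwise_conditions_of_bounded {α β : ℝ} (hα0 : 0 < α) (hα1 : α < 1) {u φ : ℂ → ℂ}
    (hu : DifferentiableOn ℂ u unitDisk) (hφd : DifferentiableOn ℂ φ unitDisk)
    (hφm : MapsTo φ unitDisk unitDisk) (h : BoundedBlochToZygmund α β u φ) :
    (∃ C : ℝ, ∀ z ∈ unitDisk,
        (1 - ‖z‖ ^ 2) ^ β * ‖2 * deriv u z * deriv φ z + u z * deriv (deriv φ) z‖
          / (1 - ‖φ z‖ ^ 2) ^ α ≤ C) ∧
      (∃ C : ℝ, ∀ z ∈ unitDisk,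
        (1 - ‖z‖ ^ 2) ^ β * (‖u z‖ * ‖deriv φ z‖ ^ 2) / (1 - ‖φ z‖ ^ 2) ^ (α + 1) ≤ C) := by
  obtain ⟨K, hK⟩ := (memZygmund_of_bounded h).2
  replace hK := forall_mem_image.1 hK
  obtain ⟨C, -, hC⟩ := exists_deriv_deriv_wcomp_le h
  set L := 2 ^ α / (1 - α)
  have hfirst : ∀ f : ℂ → ℂ, DifferentiableOn ℂ f unitDisk → f 0 = 0 →
      (∀ z ∈ unitDisk, (1 - ‖z‖ ^ 2) ^ α * ‖deriv f z‖ ≤ 2 ^ α) → ∀ z ∈ unitDisk,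
      (1 - ‖z‖ ^ 2) ^ β * ‖(2 * deriv u z * deriv φ z + u z * deriv (deriv φ) z) * deriv f (φ z)
      + u z * deriv φ z ^ 2 * deriv (deriv f) (φ z)‖ ≤ C * 2 ^ α + K * L := by
    intro f hf hf0 hN z hz
    have h1 := hC f _ hf hf0 hN z hz
    have h2 := norm_sub_zero_le_of_bloch hα0 hα1 hf hN (hφm hz)
    rw [hf0, sub_zero] at h2
    have h3 := hK hz
    rw [deriv_deriv_wcomp hu hφd hφm hf hz, add_assoc] at h1
    set T := (2 * deriv u z * deriv φ z + u z * deriv (deriv φ) z) * deriv f (φ z)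
      + u z * deriv φ z ^ 2 * deriv (deriv f) (φ z)
    have hP : 0 ≤ (1 - ‖z‖ ^ 2) ^ β := Real.rpow_nonneg (one_sub_norm_sq_pos hz).le _
    have h4 : ‖T‖ ≤ ‖deriv (deriv u) z * f (φ z) + T‖ + ‖deriv (deriv u) z‖ * ‖f (φ z)‖ := by
      rw [← norm_mul]
      simpa using norm_sub_le (deriv (deriv u) z * f (φ z) + T) (deriv (deriv u) z * f (φ z))
    have h5 : (1 - ‖z‖ ^ 2) ^ β * ‖deriv (deriv u) z‖ * ‖f (φ z)‖ ≤ K * L :=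
      mul_le_mul h3 h2 (norm_nonneg _) (le_trans (by positivity) h3)
    nlinarith [mul_le_mul_of_nonneg_left h4 hP]
  have hsecond : ∀ z ∈ unitDisk, (1 - ‖z‖ ^ 2) ^ β * (‖u z‖ * ‖deriv φ z‖ ^ 2) *
      (1 - ‖φ z‖ ^ 2) ^ (-α - 1) ≤ C * 2 ^ α + K * L := by
    intro z hz
    obtain ⟨f, hf, hf0, hN, h1, h2⟩ := exists_bloch_norm_deriv_deriv_eq hα0 (hφm hz)
    have := hfirst f hf hf0 hN z hz
    rw [h1, mul_zero, zero_add, norm_mul, norm_mul, norm_pow, h2] at this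
    linarith
  refine ⟨⟨C * 2 ^ α + K * L + α * (C * 2 ^ α + K * L), fun z hz => ?_⟩,
    C * 2 ^ α + K * L, fun z hz => ?_⟩
  · obtain ⟨f, hf, hf0, hN, h1, h2⟩ := exists_bloch_norm_deriv_eq hα0 (hφm hz)
    have h3 := hfirst f hf hf0 hN z hz
    have hP : 0 ≤ (1 - ‖z‖ ^ 2) ^ β := Real.rpow_nonneg (one_sub_norm_sq_pos hz).le _
    rw [div_eq_mul_inv, ← Real.rpow_neg (one_sub_norm_sq_pos (hφm hz)).le, ← h1, mul_assoc,
      ← norm_mul]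
    set T := (2 * deriv u z * deriv φ z + u z * deriv (deriv φ) z) * deriv f (φ z)
    have h4 := norm_sub_le (T + u z * deriv φ z ^ 2 * deriv (deriv f) (φ z))
      (u z * deriv φ z ^ 2 * deriv (deriv f) (φ z))
    rw [add_sub_cancel_right, norm_mul (u z * deriv φ z ^ 2), norm_mul (u z), norm_pow] at h4
    have h5 := mul_le_mul_of_nonneg_left h2
      (mul_nonneg hP (mul_nonneg (norm_nonneg (u z)) (sq_nonneg ‖deriv φ z‖)))
    have h6 := mul_le_mul_of_nonneg_left (hsecond z hz) hα0.le
    linarith [mul_le_mul_of_nonneg_left h4 hP]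
  · rw [div_eq_mul_inv, ← Real.rpow_neg (one_sub_norm_sq_pos (hφm hz)).le, neg_add']
    exact hsecond z hz

lemma norm_le_blochNorm {α : ℝ} (hα0 : 0 < α) (hα1 : α < 1) {f : ℂ → ℂ} (hf : MemBloch α f)
    {z : ℂ} (hz : z ∈ unitDisk) : ‖f z‖ ≤ blochNorm α f / (1 - α) := by
  have h1 := norm_sub_zero_le_of_bloch hα0 hα1 hf.1 (fun z hz => le_wnorm hf.2 hz) hz
  have h2 := norm_le_insert' (f z) (f 0)
  have h3 : ‖f 0‖ ≤ ‖f 0‖ / (1 - α) :=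
    le_div_self (norm_nonneg _) (by linarith) (by linarith)
  rw [blochNorm, add_div]
  linarith

lemma wnorm_le_blochNorm (α : ℝ) (f : ℂ → ℂ) : wnorm α (deriv f) ≤ blochNorm α f :=
  le_add_of_nonneg_left (norm_nonneg _)

/-- Sufficiency of the pointwise conditions. -/
lemma bounded_of_pointwise_conditions {α β : ℝ} (hα0 : 0 < α) (hα1 : α < 1) {u φ : ℂ → ℂ}
    (hu : MemZygmund β u) (hφd : DifferentiableOn ℂ φ unitDisk)
    (hφm : MapsTo φ unitDisk unitDisk) {A B : ℝ}
    (hA : ∀ z ∈ unitDisk,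
      (1 - ‖z‖ ^ 2) ^ β * ‖2 * deriv u z * deriv φ z + u z * deriv (deriv φ) z‖
        / (1 - ‖φ z‖ ^ 2) ^ α ≤ A)
    (hB : ∀ z ∈ unitDisk,
      (1 - ‖z‖ ^ 2) ^ β * (‖u z‖ * ‖deriv φ z‖ ^ 2) / (1 - ‖φ z‖ ^ 2) ^ (α + 1) ≤ B) :
    BoundedBlochToZygmund α β u φ := by
  obtain ⟨hud, K, hK⟩ := hu
  replace hK := forall_mem_image.1 hK
  have h1α : 0 < 1 - α := by linarith
  set D := K / (1 - α) + A + B * 4 ^ (α + 1) with hD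
  have key : ∀ f, MemBloch α f → ∀ z ∈ unitDisk,
      (1 - ‖z‖ ^ 2) ^ β * ‖deriv (deriv (wcomp u φ f)) z‖ ≤ D * blochNorm α f := by
    intro f hf z hz
    have hP : 0 ≤ (1 - ‖z‖ ^ 2) ^ β := Real.rpow_nonneg (one_sub_norm_sq_pos hz).le _
    have hp := one_sub_norm_sq_pos (hφm hz)
    have hpα := Real.rpow_pos_of_pos hp α
    have hpα1 := Real.rpow_pos_of_pos hp (α + 1)
    have hM : ∀ z ∈ unitDisk, (1 - ‖z‖ ^ 2) ^ α * ‖deriv f z‖ ≤ blochNorm α f := fun z hz =>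
      (le_wnorm hf.2 hz).trans (wnorm_le_blochNorm α f)
    have h0 := mul_le_mul (hK hz) (norm_le_blochNorm hα0 hα1 hf (hφm hz)) (norm_nonneg _)
      (le_trans (by positivity) (hK hz))
    have h1 := mul_le_mul (hA z hz) (hM _ (hφm hz)) (by positivity)
      (le_trans (by positivity) (hA z hz))
    have h2 := mul_le_mul (hB z hz) (norm_deriv_deriv_le_of_bloch hα0 hf.1 hM (hφm hz))
      (by positivity) (le_trans (by positivity) (hB z hz))
    rw [← mul_assoc, div_mul_cancel₀ _ hpα.ne'] at h1
    rw [← mul_assoc, div_mul_cancel₀ _ hpα1.ne'] at h2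
    rw [deriv_deriv_wcomp hud hφd hφm hf.1 hz]
    refine (mul_le_mul_of_nonneg_left norm_add₃_le hP).trans ?_
    simp only [norm_mul, norm_pow] at h0 h1 h2 ⊢
    rw [hD]
    linear_combination h0 + h1 + h2
  refine ⟨fun f hf => ⟨fun z hz => (hasDerivAt_wcomp hud hφd hφm hf.1
    hz).differentiableAt.differentiableWithinAt, _, forall_mem_image.2 (key f hf)⟩, ?_⟩
  have hp := Real.rpow_pos_of_pos (one_sub_norm_sq_pos (hφm zero_mem_unitDisk)) α
  set p := (1 - ‖φ 0‖ ^ 2) ^ α with hpdef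
  refine ⟨max 1 (‖u 0‖ / (1 - α) + ‖deriv u 0‖ / (1 - α) + ‖u 0‖ * ‖deriv φ 0‖ / p + D),
    by positivity, fun f hf => ?_⟩
  have hb : 0 ≤ blochNorm α f := by
    have := norm_le_blochNorm hα0 hα1 hf zero_mem_unitDisk
    rw [le_div_iff₀ h1α] at this
    exact le_trans (by positivity) this
  refine le_trans ?_ (mul_le_mul_of_nonneg_right (le_max_right _ _) hb)
  have h0 := norm_le_blochNorm hα0 hα1 hf (hφm zero_mem_unitDisk)
  have h1 : ‖deriv f (φ 0)‖ ≤ blochNorm α f / p := by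
    rw [le_div_iff₀ hp, mul_comm]
    exact (le_wnorm hf.2 (hφm zero_mem_unitDisk)).trans (wnorm_le_blochNorm α f)
  have h2 := wnorm_le (key f hf)
  have h3 : ‖wcomp u φ f 0‖ ≤ ‖u 0‖ * (blochNorm α f / (1 - α)) := by
    rw [wcomp, norm_mul]; gcongr
  have h4 : ‖deriv (wcomp u φ f) 0‖ ≤ ‖deriv u 0‖ * (blochNorm α f / (1 - α)) +
      ‖u 0‖ * (blochNorm α f / p * ‖deriv φ 0‖) := by
    rw [(hasDerivAt_wcomp hud hφd hφm hf.1 zero_mem_unitDisk).deriv]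
    refine (norm_add_le _ _).trans ?_
    simp only [norm_mul]
    gcongr
  rw [zygNorm]
  linear_combination h2 + h3 + h4

/-- **Theorem 3.1** (pointwise form). For `0 < α < 1`, `uC_φ : B^α → Z_β` is bounded iff
`u ∈ Z_β` and the two pointwise weighted suprema are finite. -/
theorem weighted_comp_bounded_Bloch_to_Zygmund_iff_of_lt_one'
    (α β : ℝ) (hα0 : 0 < α) (hα1 : α < 1) (hβ : 0 < β)
    (u φ : ℂ → ℂ) (hu : DifferentiableOn ℂ u unitDisk)
    (hφd : DifferentiableOn ℂ φ unitDisk) (hφm : Set.MapsTo φ unitDisk unitDisk) :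
    BoundedBlochToZygmund α β u φ ↔
      MemZygmund β u ∧
      (∃ C : ℝ, ∀ z ∈ unitDisk,
        (1 - ‖z‖ ^ 2) ^ β * ‖2 * deriv u z * deriv φ z + u z * deriv (deriv φ) z‖ / (1 - ‖φ z‖ ^ 2) ^ α ≤ C) ∧
      (∃ C : ℝ, ∀ z ∈ unitDisk,
        (1 - ‖z‖ ^ 2) ^ β * (‖u z‖ * ‖deriv φ z‖ ^ 2) / (1 - ‖φ z‖ ^ 2) ^ (α + 1) ≤ C) := by
  constructor
  · intro h
    exact ⟨memZygmund_of_bounded h, pointwise_conditions_of_bounded hα0 hα1 hu hφd hφm h⟩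
  · rintro ⟨hu', ⟨A, hA⟩, B, hB⟩
    exact bounded_of_pointwise_conditions hα0 hα1 hu' hφd hφm hA hB

end
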